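/- For every integer n ≥ 2, the divisorial gonality of the stacked prism graph Y_{2n,n} satisfies 2n − 1 ≤ gon(Y_{2n,n}) ≤ 2n; and for every n ≥ 3, the divisorial gonalities of the toroidal grids satisfy 2n − 2 ≤ gon(T_{n,n}) ≤ 2n and 2n − 1 ≤ gon(T_{n+1,n}) ≤ 2n. -/

import Mathlib

open SimpleGraph

/-- A tree decomposition of a graph `G`: a tree `tree` on node type `ι` with a bag of
vertices of `G` at each node, such that every vertex lies in some bag, both endpoints of
every edge lie in a common bag, and for each vertex the set of nodes whose bags contain it
induces a connected subgraph of the tree. -/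
structure TreeDecomp {V : Type*} (G : SimpleGraph V) where
  ι : Type
  tree : SimpleGraph ι
  isTree : tree.IsTree
  bag : ι → Set V
  bag_cover : ∀ v : V, ∃ t, v ∈ bag t
  bag_edge : ∀ ⦃u v : V⦄, G.Adj u v → ∃ t, u ∈ bag t ∧ v ∈ bag t
  bag_conn : ∀ v : V, (tree.induce {t | v ∈ bag t}).Connected

/-- The treewidth of `G`: the least `k` such that some tree decomposition of `G` has all
bags of size at most `k + 1` (i.e. the minimum over tree decompositions of one less than
the maximum bag size). -/
noncomputable def treewidth {V : Type*} (G : SimpleGraph V) : ℕ :=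
  sInf {k : ℕ | ∃ D : TreeDecomp G, ∀ t, (D.bag t).ncard ≤ k + 1}

/-- Two vertex sets touch if their union induces a connected subgraph. -/
def Touches {V : Type*} (G : SimpleGraph V) (A B : Set V) : Prop :=
  (G.induce (A ∪ B)).Connected

/-- A bramble: a family of vertex sets, each inducing a connected subgraph,
that pairwise touch. -/
structure IsBramble {V : Type*} (G : SimpleGraph V) (ℬ : Set (Set V)) : Prop where
  conn : ∀ B ∈ ℬ, (G.induce B).Connected
  touch : ∀ A ∈ ℬ, ∀ B ∈ ℬ, Touches G A B

/-- A strict bramble: a bramble any two of whose members share a vertex. -/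
def IsStrictBramble {V : Type*} (G : SimpleGraph V) (ℬ : Set (Set V)) : Prop :=
  IsBramble G ℬ ∧ ∀ A ∈ ℬ, ∀ B ∈ ℬ, (A ∩ B).Nonempty

/-- A hitting set for a family of vertex sets: a set meeting every member. -/
def IsHittingSet {V : Type*} (ℬ : Set (Set V)) (S : Set V) : Prop :=
  ∀ B ∈ ℬ, (S ∩ B).Nonempty

/-- The order of a bramble: the minimum size of a hitting set. -/
noncomputable def brambleOrder {V : Type*} (ℬ : Set (Set V)) : ℕ :=
  sInf {k : ℕ | ∃ S : Set V, IsHittingSet ℬ S ∧ S.ncard = k}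

/-- The bramble number of `G`: the maximum order of a bramble on `G`. -/
noncomputable def brambleNumber {V : Type*} (G : SimpleGraph V) : ℕ :=
  sSup {k : ℕ | ∃ ℬ, IsBramble G ℬ ∧ brambleOrder ℬ = k}

/-- The strict bramble number of `G`: the maximum order of a strict bramble on `G`. -/
noncomputable def strictBrambleNumber {V : Type*} (G : SimpleGraph V) : ℕ :=
  sSup {k : ℕ | ∃ ℬ, IsStrictBramble G ℬ ∧ brambleOrder ℬ = k}

/-- The `m × n` grid graph `P_m □ P_n`. -/
def gridGraph (m n : ℕ) : SimpleGraph (Fin m × Fin n) :=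
  SimpleGraph.pathGraph m □ SimpleGraph.pathGraph n

/-- The stacked prism graph `Y_{m,n} = C_m □ P_n`. -/
def stackedPrism (m n : ℕ) : SimpleGraph (Fin m × Fin n) :=
  SimpleGraph.cycleGraph m □ SimpleGraph.pathGraph n

/-- The toroidal grid graph `T_{m,n} = C_m □ C_n`. -/
def toroidalGrid (m n : ℕ) : SimpleGraph (Fin m × Fin n) :=
  SimpleGraph.cycleGraph m □ SimpleGraph.cycleGraph n

/-- `H` is a minor of `G`: there are pairwise disjoint nonempty connected branch sets in `G`,
one for each vertex of `H`, with an edge of `G` between the branch sets of any two vertices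
adjacent in `H`. -/
def IsGraphMinor {W V : Type*} (H : SimpleGraph W) (G : SimpleGraph V) : Prop :=
  ∃ B : W → Set V,
    (∀ w, (B w).Nonempty) ∧
    (∀ w, (G.induce (B w)).Connected) ∧
    (∀ w₁ w₂, w₁ ≠ w₂ → Disjoint (B w₁) (B w₂)) ∧
    (∀ ⦃w₁ w₂⦄, H.Adj w₁ w₂ → ∃ v₁ ∈ B w₁, ∃ v₂ ∈ B w₂, G.Adj v₁ v₂)

open Classical in
/-- The chip-firing move at a vertex `v`: `v` loses one chip along each incident edge,
each neighbor of `v` gains one chip. -/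
noncomputable def fireVertex {V : Type*} (G : SimpleGraph V) (D : V → ℤ) (v : V) : V → ℤ :=
  fun u => if u = v then D u - (G.neighborSet v).ncard
    else if G.Adj v u then D u + 1 else D u

/-- Two divisors on `G` are equivalent if one is obtained from the other by a finite
sequence of chip-firing moves. -/
def ChipEquiv {V : Type*} (G : SimpleGraph V) : (V → ℤ) → (V → ℤ) → Prop :=
  Relation.EqvGen (fun D D' => ∃ v, D' = fireVertex G D v)

/-- A divisor `D` wins the gonality game on `G` if for every vertex `q`, the divisor
`D - q` is equivalent to an effective divisor. -/
def WinsGonalityGame {V : Type*} [DecidableEq V] (G : SimpleGraph V) (D : V → ℤ) : Prop :=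
  ∀ q : V, ∃ E : V → ℤ, (∀ v, 0 ≤ E v) ∧
    ChipEquiv G (fun v => D v - if v = q then 1 else 0) E

/-- The divisorial gonality of `G`: the least degree of an effective divisor winning the
gonality game. -/
noncomputable def gonality {V : Type*} [Fintype V] [DecidableEq V] (G : SimpleGraph V) : ℕ :=
  sInf {k : ℕ | ∃ D : V → ℤ, (∀ v, 0 ≤ D v) ∧ (∑ v, D v) = (k : ℤ) ∧ WinsGonalityGame G D}

section ChipFiring

open Classical

/-- The sum of `φ` over the neighbors of `v`. -/
noncomputable def nbrSum {V : Type*} [Fintype V] (G : SimpleGraph V) (v : V) (φ : V → ℤ) : ℤ :=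
  ∑ w, if G.Adj v w then φ w else 0

/-- The graph Laplacian on integer-valued functions. -/
noncomputable def lap {V : Type*} [Fintype V] (G : SimpleGraph V) (f : V → ℤ) (v : V) : ℤ :=
  nbrSum G v fun w => f v - f w

/-- The number of edges of `G` leaving `U`. -/
noncomputable def edgeCut {V : Type*} [Fintype V] (G : SimpleGraph V) (U : Set V) : ℤ :=
  ∑ v, nbrSum G v fun w => if v ∈ U ∧ w ∉ U then 1 else 0

section General

variable {V : Type*} [Fintype V] {G : SimpleGraph V}

lemma nbrSum_eq_sum {v : V} {s : Finset V} (hs : ∀ w, G.Adj v w ↔ w ∈ s) (φ : V → ℤ) :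
    nbrSum G v φ = ∑ w ∈ s, φ w := by
  rw [nbrSum, ← Finset.sum_filter]
  congr 1
  ext w
  simp [hs]

lemma nbrSum_mono {v : V} {φ ψ : V → ℤ} (h : ∀ w, G.Adj v w → φ w ≤ ψ w) :
    nbrSum G v φ ≤ nbrSum G v ψ := by
  refine Finset.sum_le_sum fun w _ => ?_
  split_ifs with hw
  exacts [h w hw, le_rfl]

lemma nbrSum_zero (v : V) : nbrSum G v (fun _ => 0) = 0 := by
  simp [nbrSum]

lemma nbrSum_nonneg {v : V} {φ : V → ℤ} (h : ∀ w, G.Adj v w → 0 ≤ φ w) :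
    0 ≤ nbrSum G v φ := by
  rw [← nbrSum_zero (G := G) v]
  exact nbrSum_mono h

lemma le_nbrSum {v w : V} {φ : V → ℤ} (hw : G.Adj v w) (h : ∀ w, 0 ≤ φ w) :
    φ w ≤ nbrSum G v φ := by
  have := Finset.single_le_sum (f := fun w => if G.Adj v w then φ w else 0)
    (fun u _ => by split_ifs; exacts [h u, le_rfl]) (Finset.mem_univ w)
  simpa [nbrSum, hw] using this

lemma lap_add (f g : V → ℤ) (v : V) : lap G (f + g) v = lap G f v + lap G g v := by
  simp only [lap, nbrSum, ← Finset.sum_add_distrib, Pi.add_apply]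
  refine Finset.sum_congr rfl fun w _ => ?_
  split_ifs <;> ring

lemma lap_neg (f : V → ℤ) (v : V) : lap G (-f) v = -lap G f v := by
  simp only [lap, nbrSum, ← Finset.sum_neg_distrib, Pi.neg_apply]
  refine Finset.sum_congr rfl fun w _ => ?_
  split_ifs <;> ring

lemma lap_zero (v : V) : lap G 0 v = 0 := by
  simp [lap, nbrSum]

lemma sum_lap (f : V → ℤ) : ∑ v, lap G f v = 0 := by
  have h : ∑ v, lap G f v = -∑ v, lap G f v := by
    conv_lhs => simp only [lap, nbrSum]
    rw [Finset.sum_comm]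
    simp only [lap, nbrSum, ← Finset.sum_neg_distrib]
    refine Finset.sum_congr rfl fun v _ => Finset.sum_congr rfl fun w _ => ?_
    rw [G.adj_comm]
    split_ifs <;> ring
  omega

lemma fireVertex_eq (D : V → ℤ) (v : V) :
    fireVertex G D v = fun u => D u - lap G (Pi.single v 1) u := by
  funext u
  unfold fireVertex lap nbrSum
  split_ifs with huv hadj
  · subst huv
    congr 1
    rw [Set.ncard_eq_toFinset_card', Finset.card_eq_sum_ones, Nat.cast_sum]
    rw [← Finset.sum_filter]
    refine Finset.sum_congr (by ext; simp) fun w hw => ?_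
    have hw : G.Adj u w := by simpa using hw
    simp [hw.ne']
  · rw [Finset.sum_eq_single v]
    · simp [hadj.symm, huv]
    · intro w _ hw
      simp [huv, hw]
    · simp
  · rw [Finset.sum_eq_zero, sub_zero]
    intro w _
    split_ifs with h
    · have : w ≠ v := by
        rintro rfl
        exact hadj h.symm
      simp [huv, this]
    · rfl

lemma chipEquiv_iff (D D' : V → ℤ) :
    ChipEquiv G D D' ↔ ∃ f : V → ℤ, D' = fun v => D v - lap G f v := by
  constructor
  · intro h
    induction h with
    | rel D D' h =>
      obtain ⟨v, rfl⟩ := h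
      exact ⟨_, fireVertex_eq D v⟩
    | refl D => exact ⟨0, by simp [lap_zero]⟩
    | symm D D' _ ih =>
      obtain ⟨f, rfl⟩ := ih
      exact ⟨-f, by simp [lap_neg]⟩
    | trans D D' D'' _ _ ih₁ ih₂ =>
      obtain ⟨f, rfl⟩ := ih₁
      obtain ⟨g, rfl⟩ := ih₂
      exact ⟨f + g, by funext v; rw [lap_add]; ring⟩
  · rintro ⟨f, rfl⟩
    let S : AddSubgroup (V → ℤ) :=
      { carrier := {f | ∀ D : V → ℤ, ChipEquiv G D fun v => D v - lap G f v}
        zero_mem' := fun D => by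
          simp only [lap_zero, sub_zero]
          exact Relation.EqvGen.refl _
        add_mem' := fun {f g} hf hg D => by
          refine Relation.EqvGen.trans _ _ _ (hf D) ?_
          have := hg fun v => D v - lap G f v
          simp only [sub_sub, ← lap_add] at this
          exact this
        neg_mem' := fun {f} hf D => by
          refine Relation.EqvGen.symm _ _ ?_
          have h : ChipEquiv G (fun v => D v - lap G (-f) v)
              fun v => D v - lap G (-f) v - lap G f v := hf _
          have hD : (fun v => D v - lap G (-f) v - lap G f v) = D := by
            funext v
            rw [lap_neg]
            ring
          rwa [hD] at h }
    have hf : f ∈ S := by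
      rw [← Finset.univ_sum_single f]
      refine S.sum_mem fun v _ => ?_
      have : (Pi.single v (f v) : V → ℤ) = f v • Pi.single v 1 := by
        rw [← Pi.single_smul]; simp
      rw [this]
      refine S.zsmul_mem (fun D => ?_) _
      rw [← fireVertex_eq]
      exact Relation.EqvGen.rel _ _ ⟨v, rfl⟩
    exact hf D

lemma winsGonalityGame_iff [DecidableEq V] (D : V → ℤ) :
    WinsGonalityGame G D ↔
      ∀ q, ∃ f : V → ℤ, ∀ v, 0 ≤ (D v - if v = q then 1 else 0) - lap G f v := by
  refine forall_congr' fun q => ⟨?_, ?_⟩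
  · rintro ⟨E, hE, h⟩
    obtain ⟨f, rfl⟩ := (chipEquiv_iff _ _).1 h
    exact ⟨f, hE⟩
  · rintro ⟨f, hf⟩
    exact ⟨_, hf, (chipEquiv_iff _ _).2 ⟨f, rfl⟩⟩

lemma lap_indicator_of_notMem {U : Set V} {v : V} (hv : v ∉ U) :
    lap G (U.indicator 1) v = -nbrSum G v (U.indicator 1) := by
  simp only [lap, nbrSum, ← Finset.sum_neg_distrib]
  refine Finset.sum_congr rfl fun w _ => ?_
  simp [hv, neg_ite]

lemma lap_indicator_of_mem {U : Set V} {v : V} (hv : v ∈ U) :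
    lap G (U.indicator 1) v = nbrSum G v fun w => if v ∈ U ∧ w ∉ U then 1 else 0 := by
  simp only [lap]
  congr 1
  funext w
  by_cases hw : w ∈ U <;> simp [hv, hw]

lemma lap_indicator_nonneg {U : Set V} {v : V} (hv : v ∈ U) :
    0 ≤ lap G (U.indicator 1) v := by
  rw [lap_indicator_of_mem hv]
  exact nbrSum_nonneg fun w _ => by positivity

lemma lap_indicator_pos {U : Set V} {v w : V} (hv : v ∈ U) (hw : w ∉ U) (h : G.Adj v w) :
    1 ≤ lap G (U.indicator 1) v := by
  rw [lap_indicator_of_mem hv]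
  refine le_trans ?_ (le_nbrSum h fun w => by positivity)
  simp [hv, hw]

lemma lap_indicator_nonpos {U : Set V} {v : V} (hv : v ∉ U) :
    lap G (U.indicator 1) v ≤ 0 := by
  rw [lap_indicator_of_notMem hv, neg_nonpos]
  exact nbrSum_nonneg fun w _ => Set.indicator_nonneg (by simp) w

lemma lap_indicator_neg {U : Set V} {v w : V} (hv : v ∉ U) (hw : w ∈ U) (h : G.Adj v w) :
    lap G (U.indicator 1) v ≤ -1 := by
  rw [lap_indicator_of_notMem hv, neg_le_neg_iff]
  refine le_trans ?_ (le_nbrSum h fun w => Set.indicator_nonneg (by simp) w)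
  simp [hw]

/-- Legally firing `U` requires a chip for each edge leaving `U`. -/
lemma edgeCut_le_degree {D : V → ℤ} {U : Set V} (hD : ∀ v, 0 ≤ D v)
    (hfire : ∀ v, 0 ≤ D v - lap G (U.indicator 1) v) : edgeCut G U ≤ ∑ v, D v := by
  refine Finset.sum_le_sum fun v _ => ?_
  by_cases hv : v ∈ U
  · rw [← lap_indicator_of_mem hv]
    linarith [hfire v]
  · simpa [hv, nbrSum_zero] using hD v

/-- Truncating a firing script between effective divisors from below leaves the
divisor effective. -/
lemma effective_truncate {D f : V → ℤ} (hD : ∀ v, 0 ≤ D v) (hf : ∀ v, 0 ≤ D v - lap G f v)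
    (t : ℤ) (v : V) : 0 ≤ D v - lap G (fun w => max (f w - t) 0) v := by
  rcases le_total (f v) t with h | h
  · have : lap G (fun w => max (f w - t) 0) v ≤ 0 :=
      (nbrSum_mono fun w _ => by dsimp only; omega).trans_eq (nbrSum_zero v)
    linarith [hD v]
  · have : lap G (fun w => max (f w - t) 0) v ≤ lap G f v :=
      nbrSum_mono fun w _ => by dsimp only; omega
    linarith [hf v]

lemma lap_truncate_step (f : V → ℤ) (t : ℤ) (v : V) :
    lap G (fun w => max (f w - t) 0) v =
      lap G (fun w => max (f w - (t + 1)) 0) v + lap G ({w | t < f w}.indicator 1) v := by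
  rw [← lap_add]
  congr 1
  funext w
  by_cases h : t < f w
  · simp only [Pi.add_apply, Set.indicator_of_mem (show w ∈ {w | t < f w} from h), Pi.one_apply]
    omega
  · simp only [Pi.add_apply, Set.indicator_of_notMem (show w ∉ {w | t < f w} from h)]
    omega

end General

lemma Int.exists_step {P : ℤ → Prop} {a b : ℤ} (hab : a ≤ b) (ha : P a) (hb : ¬P b) :
    ∃ t, a ≤ t ∧ P t ∧ ¬P (t + 1) := by
  by_contra! h
  exact hb (Int.leInduction ha (fun n hn => h n hn) b hab)

/-- The scramble number bound: if `E` is a family of connected vertex sets such that every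
effective divisor meeting all of them has degree at least `k`, and any edge cut separating two
of them has size at least `k`, then winning divisors have degree at least `k`. -/
theorem scramble_le_degree {V ι : Type*} [Fintype V] [DecidableEq V] [Fintype ι]
    {G : SimpleGraph V} {E : ι → Set V} {k : ℤ}
    (hne : ∀ i, (E i).Nonempty)
    (hconn : ∀ i (U : Set V), (∃ u ∈ E i, u ∈ U) → (∃ v ∈ E i, v ∉ U) →
      ∃ u ∈ E i, ∃ v ∈ E i, u ∈ U ∧ v ∉ U ∧ G.Adj u v)
    (hhit : ∀ D : V → ℤ, (∀ v, 0 ≤ D v) → (∀ i, ∃ v ∈ E i, 0 < D v) → k ≤ ∑ v, D v)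
    (hcut : ∀ i j (U : Set V), (∀ v ∈ E i, v ∈ U) → (∀ v ∈ E j, v ∉ U) → k ≤ edgeCut G U)
    {D : V → ℤ} (hD : ∀ v, 0 ≤ D v) (hwin : WinsGonalityGame G D) : k ≤ ∑ v, D v := by
  rw [winsGonalityGame_iff] at hwin
  by_contra! hlt
  let hits : (V → ℤ) → Finset ι := fun D => {i | ∃ v ∈ E i, 0 < D v}
  have mem_hits : ∀ D i, i ∈ hits D ↔ ∃ v ∈ E i, 0 < D v := by simp [hits]
  obtain ⟨g, hg, hmax⟩ : ∃ g : V → ℤ, (∀ v, 0 ≤ D v - lap G g v) ∧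
      ∀ g' : V → ℤ, (∀ v, 0 ≤ D v - lap G g' v) →
        (hits fun v => D v - lap G g' v).card ≤ (hits fun v => D v - lap G g v).card := by
    have hfin : (Set.range fun g : {g : V → ℤ // ∀ v, 0 ≤ D v - lap G g v} =>
        (hits fun v => D v - lap G g.1 v).card).Finite :=
      (Set.finite_Iic (Fintype.card ι)).subset (by
        rintro _ ⟨g, rfl⟩
        exact Finset.card_le_univ _)
    obtain ⟨_, ⟨g, rfl⟩, hg⟩ := Set.exists_max_image _ id hfin
      ⟨_, ⟨⟨0, by simpa [lap_zero] using hD⟩, rfl⟩⟩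
    exact ⟨g.1, g.2, fun g' hg' => hg _ ⟨⟨g', hg'⟩, rfl⟩⟩
  set D₀ : V → ℤ := fun v => D v - lap G g v with hD₀
  have hsum : ∀ f : V → ℤ, ∑ v, (D v - lap G f v) = ∑ v, D v := fun f => by
    rw [Finset.sum_sub_distrib, sum_lap, sub_zero]
  obtain ⟨j, hj⟩ : ∃ j, ∀ v ∈ E j, D₀ v ≤ 0 := by
    by_contra! h
    have := hhit D₀ hg h
    rw [hsum] at this
    omega
  obtain ⟨q, hq⟩ := hne j
  obtain ⟨f', hf'⟩ := hwin q
  obtain ⟨f, rfl⟩ : ∃ f, f' = g + f := ⟨f' - g, by simp⟩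
  simp only [lap_add] at hf'
  have hf : ∀ v, 0 ≤ D₀ v - lap G f v := fun v => by
    have := hf' v
    simp only [hD₀]
    split_ifs at this <;> linarith
  have hfq : 1 ≤ D₀ q - lap G f q := by
    have := hf' q
    simp only [if_true] at this
    simp only [hD₀]
    linarith
  obtain ⟨a, ha⟩ : ∃ a, ∀ v, a ≤ f v :=
    ⟨_, fun v => (Set.finite_range f).bddBelow.some_mem ⟨v, rfl⟩⟩
  obtain ⟨b, hb⟩ : ∃ b, ∀ v, f v ≤ b :=
    ⟨_, fun v => (Set.finite_range f).bddAbove.some_mem ⟨v, rfl⟩⟩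
  let T : ℤ → V → ℤ := fun t v => D₀ v - lap G (fun w => max (f w - t) 0) v
  have hT : ∀ t v, 0 ≤ T t v := effective_truncate hg hf
  have hstep : ∀ t v, T t v = T (t + 1) v - lap G ({w | t < f w}.indicator 1) v := fun t v => by
    simp only [T, lap_truncate_step f t v]
    ring
  have hTb : ∀ t, b ≤ t → T t = D₀ := fun t ht => by
    have : (fun w => max (f w - t) 0) = 0 := by
      funext w
      have := hb w
      simp only [Pi.zero_apply]
      omega
    funext v
    simp [T, this, lap_zero]
  have hTa : T a q = D₀ q - lap G f q := by
    simp only [T, lap]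
    congr 2
    funext w
    have := ha w
    have := ha q
    omega
  have hab : a ≤ b := (ha q).trans (hb q)
  obtain ⟨t, hat, ⟨v, hv, hvt⟩, htj⟩ := Int.exists_step (P := fun t => ∃ v ∈ E j, 0 < T t v) hab
    ⟨q, hq, by omega⟩ (by
      rintro ⟨v, hv, h⟩
      rw [hTb b le_rfl] at h
      exact absurd (hj v hv) (by omega))
  push Not at htj
  have hjt : ∀ v ∈ E j, f v ≤ t := by
    by_contra! h
    have hout : v ∉ {w | t < f w} := fun hvU => by
      have := lap_indicator_nonneg (G := G) hvU
      have := hstep t v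
      have := htj v hv
      omega
    obtain ⟨u, hu, w, hw, huU, hwU, huw⟩ := hconn j {w | t < f w} h ⟨v, hv, hout⟩
    have := lap_indicator_pos huU hwU huw
    have := hstep t u
    have := htj u hu
    have := hT t u
    omega
  obtain ⟨i, hi, hit⟩ : ∃ i ∈ hits D₀, i ∉ hits (T t) := by
    by_contra! h
    have hss : hits D₀ ⊂ hits (T t) := by
      refine (Finset.ssubset_iff_of_subset h).2 ⟨j, (mem_hits _ _).2 ⟨v, hv, hvt⟩, fun hj' => ?_⟩
      obtain ⟨w, hw, hpos⟩ := (mem_hits _ _).1 hj'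
      exact absurd (hj w hw) (by omega)
    have hTt : T t = fun v => D v - lap G (g + fun w => max (f w - t) 0) v := by
      funext v
      simp only [T, hD₀, lap_add]
      ring
    have hle := hmax (g + fun w => max (f w - t) 0) (fun v => by
      have := hT t v
      rwa [hTt] at this)
    rw [← hTt] at hle
    exact absurd (Finset.card_lt_card hss) (by omega)
  obtain ⟨s, hts, hs, hs'⟩ := Int.exists_step (P := fun s => ∀ v ∈ E i, T s v ≤ 0)
    (le_max_left t b) (by simpa [mem_hits] using hit) (by
      rw [hTb _ (le_max_right t b)]
      simpa [mem_hits] using hi)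
  push Not at hs'
  obtain ⟨v, hv, hvs⟩ := hs'
  have his : ∀ w ∈ E i, w ∈ {w | s < f w} := by
    by_contra! h
    have hvU : v ∈ {w | s < f w} := by
      by_contra hvU
      have := lap_indicator_nonpos (G := G) hvU
      have := hstep s v
      have := hs v hv
      omega
    obtain ⟨u, hu, w, hw, huU, hwU, huw⟩ := hconn i {w | s < f w} ⟨v, hv, hvU⟩ h
    have := lap_indicator_neg hwU huU huw.symm
    have := hstep s w
    have := hs w hw
    have := hT (s + 1) w
    omega
  have hk := hcut i j {w | s < f w} his fun w hw => by
    have := hjt w hw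
    simp only [Set.mem_ofPred_eq]
    omega
  have hle := edgeCut_le_degree (G := G) (U := {w | s < f w}) (hT (s + 1)) fun w => by
    rw [← hstep]
    exact hT s w
  have hdeg : ∑ w, T (s + 1) w = ∑ w, D w := by
    simp only [T]
    rw [Finset.sum_sub_distrib, sum_lap, sub_zero, hD₀, hsum]
  omega

section BoxProd

variable {V W : Type*} [Fintype V] [Fintype W] {G : SimpleGraph V} {H : SimpleGraph W}

lemma nbrSum_boxProd (v : V × W) (φ : V × W → ℤ) :
    nbrSum (G □ H) v φ =
      nbrSum G v.1 (fun x => φ (x, v.2)) + nbrSum H v.2 fun y => φ (v.1, y) := by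
  have h : ∀ w : V × W, (if (G □ H).Adj v w then φ w else 0) =
      (if w.2 = v.2 then if G.Adj v.1 w.1 then φ w else 0 else 0) +
        if w.1 = v.1 then if H.Adj v.2 w.2 then φ w else 0 else 0 := by
    rintro ⟨x, y⟩
    obtain ⟨a, b⟩ := v
    simp only [boxProd_adj]
    by_cases hx : x = a <;> by_cases hy : y = b <;> simp [hx, hy, Ne.symm]
  simp only [nbrSum, h, Finset.sum_add_distrib]
  congr 1
  · rw [Fintype.sum_prod_type]
    simp
  · rw [Fintype.sum_prod_type_right]
    simp

lemma edgeCut_boxProd (U : Set (V × W)) :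
    edgeCut (G □ H) U =
      ∑ y, edgeCut G {x | (x, y) ∈ U} + ∑ x, edgeCut H {y | (x, y) ∈ U} := by
  simp only [edgeCut, nbrSum_boxProd, Finset.sum_add_distrib, Set.mem_ofPred_eq]
  congr 1
  · rw [Fintype.sum_prod_type_right]
  · rw [Fintype.sum_prod_type]

lemma edgeCut_nonneg (U : Set V) : 0 ≤ edgeCut G U :=
  Finset.sum_nonneg fun _ _ => nbrSum_nonneg fun _ _ => by positivity

/-- A winning divisor on `G` pulls back to a winning divisor on `G □ H`. -/
lemma WinsGonalityGame.boxProd [DecidableEq V] [DecidableEq W] {D : V → ℤ}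
    (h : WinsGonalityGame G D) : WinsGonalityGame (G □ H) fun v => D v.1 := by
  rw [winsGonalityGame_iff] at h ⊢
  rintro ⟨a, b⟩
  obtain ⟨f, hf⟩ := h a
  refine ⟨fun v => f v.1, fun ⟨x, y⟩ => ?_⟩
  have hlap : lap (G □ H) (fun v => f v.1) (x, y) = lap G f x := by
    simp [lap, nbrSum_boxProd, nbrSum_zero]
  rw [hlap]
  have := hf x
  by_cases hx : x = a
  · simp only [hx, if_true] at this
    simp only [hx, Prod.mk.injEq, true_and]
    split_ifs <;> omega
  · simpa [hx] using this

end BoxProd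

section Cycle

open scoped Fin.CommRing

variable {k : ℕ}

lemma cycleGraph_adj_add_one (x : Fin (k + 3)) : (cycleGraph (k + 3)).Adj x (x + 1) := by
  rw [cycleGraph_adj]
  right
  ring

lemma add_one_ne_sub_one (x : Fin (k + 3)) : x + 1 ≠ x - 1 := by
  intro h
  have h2 : (1 + 1 : Fin (k + 3)) = 0 := by linear_combination h
  have h3 := congrArg Fin.val h2
  rw [Fin.val_add, Fin.val_one, Nat.mod_eq_of_lt (by omega)] at h3
  simp at h3

lemma nbrSum_cycleGraph (x : Fin (k + 3)) (φ : Fin (k + 3) → ℤ) :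
    nbrSum (cycleGraph (k + 3)) x φ = φ (x + 1) + φ (x - 1) := by
  rw [nbrSum_eq_sum (s := {x + 1, x - 1}), Finset.sum_pair (add_one_ne_sub_one x)]
  intro w
  simp only [cycleGraph_adj, Finset.mem_insert, Finset.mem_singleton]
  rw [or_comm]
  refine or_congr ?_ ?_ <;> constructor <;> intro h <;> grind

lemma winsGonalityGame_cycleGraph :
    WinsGonalityGame (cycleGraph (k + 3)) fun v => if v = 0 then 2 else 0 := by
  rw [winsGonalityGame_iff]
  intro q
  refine ⟨fun x => max 0 (max (min (q : ℤ) (k + 3 - q) - x)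
    (min (q : ℤ) (k + 3 - q) - (k + 3 - x))), fun v => ?_⟩
  rw [lap, nbrSum_cycleGraph]
  have hq := q.2
  have hv := v.2
  have h1 : ((v + 1 : Fin (k + 3)) : ℕ) = if (v : ℕ) = k + 2 then 0 else (v : ℕ) + 1 := by
    rw [Fin.val_add_one]
    simp [Fin.ext_iff]
  have h2 : ((v - 1 : Fin (k + 3)) : ℕ) = if (v : ℕ) = 0 then k + 2 else (v : ℕ) - 1 := by
    rcases Nat.eq_zero_or_pos (v : ℕ) with h | h
    · simp [Fin.val_sub, h]
    · have : (k + 3 - 1 + (v : ℕ)) = (v - 1 : ℕ) + (k + 3) := by omega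
      rw [if_neg h.ne', Fin.val_sub, Fin.val_one, this, Nat.add_mod_right,
        Nat.mod_eq_of_lt (by omega)]
  simp only [h1, h2, Fin.ext_iff, Fin.val_zero]
  split_ifs <;> push_cast <;> omega

/-- A set of vertices of a cycle closed under adding `1` is everything. -/
lemma forall_of_add_closed {S : Set (Fin (k + 3))} {a : Fin (k + 3)} (ha : a ∈ S)
    (h : ∀ x ∈ S, x + 1 ∈ S) (b : Fin (k + 3)) : b ∈ S := by
  have key : ∀ n : ℕ, a + (n : Fin (k + 3)) ∈ S := fun n => by
    induction n with
    | zero => simpa using ha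
    | succ n ih =>
      rw [Nat.cast_succ, ← add_assoc]
      exact h _ ih
  have := key (b - a : Fin (k + 3)).val
  rwa [Fin.cast_val_eq_self, add_sub_cancel] at this

lemma two_le_edgeCut_cycleGraph {S : Set (Fin (k + 3))} {a b : Fin (k + 3)} (ha : a ∈ S)
    (hb : b ∉ S) : 2 ≤ edgeCut (cycleGraph (k + 3)) S := by
  obtain ⟨x, hx, hx'⟩ : ∃ x ∈ S, x + 1 ∉ S := by
    by_contra! h
    exact hb (forall_of_add_closed ha h b)
  obtain ⟨y, hy, hy'⟩ : ∃ y ∉ S, y + 1 ∈ S := by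
    by_contra! h
    exact forall_of_add_closed (S := Sᶜ) hb h a ha
  simp only [edgeCut, nbrSum_cycleGraph, Finset.sum_add_distrib]
  have h1 := Finset.single_le_sum
    (f := fun v : Fin (k + 3) => if v ∈ S ∧ v + 1 ∉ S then (1 : ℤ) else 0)
    (fun _ _ => by positivity) (Finset.mem_univ x)
  have h2 := Finset.single_le_sum
    (f := fun v : Fin (k + 3) => if v ∈ S ∧ v - 1 ∉ S then (1 : ℤ) else 0)
    (fun _ _ => by positivity) (Finset.mem_univ (y + 1))
  simp only [hx, hx', hy, hy', add_sub_cancel_right, not_false_eq_true, and_self, if_true]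
    at h1 h2
  linarith

/-- A cycle with one vertex removed is connected. -/
lemma exists_adj_cycleGraph_avoiding {S : Set (Fin (k + 3))} {p a b : Fin (k + 3)}
    (ha : a ∈ S) (hap : a ≠ p) (hb : b ∉ S) (hbp : b ≠ p) :
    ∃ x y, x ≠ p ∧ y ≠ p ∧ x ∈ S ∧ y ∉ S ∧ (cycleGraph (k + 3)).Adj x y := by
  by_contra! h
  have step : ∀ x, x ≠ p → x + 1 ≠ p → (x ∈ S ↔ x + 1 ∈ S) := fun x hx hx' =>
    ⟨fun hS => by_contra fun hS' => h x (x + 1) hx hx' hS hS' (cycleGraph_adj_add_one x),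
      fun hS => by_contra fun hS' => h (x + 1) x hx' hx hS hS' (cycleGraph_adj_add_one x).symm⟩
  have key : ∀ x, x ≠ p → (x ∈ S ↔ p + 1 ∈ S) := fun x => by
    refine forall_of_add_closed (S := {x | x ≠ p → (x ∈ S ↔ p + 1 ∈ S)}) (a := p)
      (fun h => absurd rfl h) (fun x hx hx' => ?_) x
    by_cases hxp : x = p
    · rw [hxp]
    · rw [← step x hxp hx', hx hxp]
  exact hb ((key b hbp).2 ((key a hap).1 ha))

end Cycle

section Bounds

variable {W : Type*} [Fintype W] [DecidableEq W] {H : SimpleGraph W} {k : ℕ}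

lemma gonality_cycleGraph_boxProd_mem :
    2 * Fintype.card W ∈ {d : ℕ | ∃ D : Fin (k + 3) × W → ℤ, (∀ v, 0 ≤ D v) ∧
      (∑ v, D v) = (d : ℤ) ∧ WinsGonalityGame (cycleGraph (k + 3) □ H) D} := by
  refine ⟨_, fun v => ?_, ?_, winsGonalityGame_cycleGraph.boxProd⟩
  · positivity
  · rw [Fintype.sum_prod_type_right]
    simp [mul_comm]

lemma gonality_cycleGraph_boxProd_le :
    gonality (cycleGraph (k + 3) □ H) ≤ 2 * Fintype.card W :=
  Nat.sInf_le gonality_cycleGraph_boxProd_mem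

lemma le_gonality_cycleGraph_boxProd {d : ℕ}
    (h : ∀ D : Fin (k + 3) × W → ℤ, (∀ v, 0 ≤ D v) →
      WinsGonalityGame (cycleGraph (k + 3) □ H) D → (d : ℤ) ≤ ∑ v, D v) :
    d ≤ gonality (cycleGraph (k + 3) □ H) := by
  refine le_csInf ⟨_, gonality_cycleGraph_boxProd_mem⟩ ?_
  rintro m ⟨D, hD, hm, hwin⟩
  exact_mod_cast hm ▸ h D hD hwin

/-- The copies of `H` form a scramble on the product of a cycle with a connected graph `H`. -/
theorem le_gonality_cycleGraph_boxProd_of_connected (hH : H.Connected) {d : ℕ} (hd : d ≤ k + 3)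
    (hd' : d ≤ 2 * Fintype.card W) : d ≤ gonality (cycleGraph (k + 3) □ H) := by
  refine le_gonality_cycleGraph_boxProd fun D hD hwin => ?_
  refine scramble_le_degree (E := fun x : Fin (k + 3) => {v | v.1 = x}) ?_ ?_ ?_ ?_ hD hwin
  · intro x
    exact ⟨(x, hH.nonempty.some), rfl⟩
  · rintro x U ⟨⟨_, u⟩, rfl, hu⟩ ⟨⟨x, v⟩, rfl, hv⟩
    obtain ⟨p⟩ := hH.preconnected u v
    obtain ⟨e, -, he, he'⟩ := p.exists_boundary_dart {y | (x, y) ∈ U} hu hv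
    exact ⟨(x, e.fst), rfl, (x, e.snd), rfl, he, he', by simp [boxProd_adj, e.adj]⟩
  · intro D hD hhit
    have : ∀ x : Fin (k + 3), (1 : ℤ) ≤ ∑ y, D (x, y) := fun x => by
      obtain ⟨⟨_, y⟩, rfl, hy⟩ := hhit x
      exact hy.trans_le
        (Finset.single_le_sum (f := fun y => D (_, y)) (fun _ _ => hD _) (Finset.mem_univ y))
    have := Finset.sum_le_sum fun x (_ : x ∈ Finset.univ) => this x
    rw [← Fintype.sum_prod_type] at this
    simp at this
    omega
  · intro i j U hi hj
    have h1 : ∀ y : W, (2 : ℤ) ≤ edgeCut (cycleGraph (k + 3)) {x | (x, y) ∈ U} := fun y =>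
      two_le_edgeCut_cycleGraph (a := i) (b := j) (hi (i, y) rfl) (hj (j, y) rfl)
    have h1 := Finset.sum_le_sum fun y (_ : y ∈ Finset.univ) => h1 y
    have h2 := Finset.sum_nonneg fun x (_ : x ∈ Finset.univ) =>
      edgeCut_nonneg (G := H) {y | (x, y) ∈ U}
    rw [edgeCut_boxProd]
    simp at h1
    omega

/-- The copies of the second cycle with one vertex removed form a scramble on a toroidal grid
with first cycle at least as long as the second. -/
theorem le_gonality_toroidalGrid {l : ℕ} (hlk : l ≤ k) :
    2 * (l + 3) ≤ gonality (toroidalGrid (k + 3) (l + 3)) := by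
  refine le_gonality_cycleGraph_boxProd fun D hD hwin => ?_
  have hthird : ∀ p q : Fin (l + 3), ∃ y, y ≠ p ∧ y ≠ q := fun p q => by
    obtain ⟨y, hy⟩ := Finset.exists_mem_notMem_of_card_lt_card
      (s := {p, q}) (t := (Finset.univ : Finset (Fin (l + 3))))
      (Finset.card_le_two.trans_lt (by simp))
    exact ⟨y, by simpa using hy⟩
  refine scramble_le_degree
    (E := fun i : Fin (k + 3) × Fin (l + 3) => {v | v.1 = i.1 ∧ v.2 ≠ i.2}) ?_ ?_ ?_ ?_ hD hwin
  · rintro ⟨x, p⟩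
    obtain ⟨y, hy, -⟩ := hthird p p
    exact ⟨(x, y), rfl, hy⟩
  · rintro ⟨x, p⟩ U ⟨⟨_, u⟩, ⟨rfl, hup⟩, hu⟩ ⟨⟨_, v⟩, ⟨rfl, hvp⟩, hv⟩
    obtain ⟨a, b, hap, hbp, ha, hb, hab⟩ :=
      exists_adj_cycleGraph_avoiding (S := {y | (_, y) ∈ U}) hu hup hv hvp
    exact ⟨(_, a), ⟨rfl, hap⟩, (_, b), ⟨rfl, hbp⟩, ha, hb, by simpa [boxProd_adj] using hab⟩
  · intro D hD hhit
    have : ∀ x : Fin (k + 3), (2 : ℤ) ≤ ∑ y, D (x, y) := fun x => by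
      obtain ⟨⟨x', p⟩, ⟨hx, -⟩, hp⟩ := hhit (x, 0)
      obtain ⟨⟨x'', q⟩, ⟨hx', hqp⟩, hq⟩ := hhit (x, p)
      obtain rfl : x' = x := hx
      obtain rfl : x'' = x' := hx'
      replace hqp : q ≠ p := hqp
      have := Finset.sum_le_sum_of_subset_of_nonneg (Finset.subset_univ {q, p})
        (f := fun y => D (x'', y)) fun _ _ _ => hD _
      rw [Finset.sum_pair hqp] at this
      omega
    have := Finset.sum_le_sum fun x (_ : x ∈ Finset.univ) => this x
    rw [← Fintype.sum_prod_type] at this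
    simp at this
    push_cast
    omega
  · rintro ⟨a, p⟩ ⟨b, q⟩ U hi hj
    have hab : a ≠ b := by
      rintro rfl
      obtain ⟨y, hyp, hyq⟩ := hthird p q
      exact hj (a, y) ⟨rfl, hyq⟩ (hi (a, y) ⟨rfl, hyp⟩)
    have hrow : ∀ y : Fin (l + 3), (2 : ℤ) ≤ edgeCut (cycleGraph (k + 3)) {x | (x, y) ∈ U} +
        (if y = p then edgeCut (cycleGraph (l + 3)) {y | (a, y) ∈ U} else 0) +
        if y = q then edgeCut (cycleGraph (l + 3)) {y | (b, y) ∈ U} else 0 := fun y => by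
      have h0 := edgeCut_nonneg (G := cycleGraph (k + 3)) {x | (x, y) ∈ U}
      have h1 := edgeCut_nonneg (G := cycleGraph (l + 3)) {y | (a, y) ∈ U}
      have h2 := edgeCut_nonneg (G := cycleGraph (l + 3)) {y | (b, y) ∈ U}
      by_cases hay : (a, y) ∈ U
      · by_cases hby : (b, y) ∈ U
        · have hy : y = q := by
            by_contra hy
            exact hj (b, y) ⟨rfl, hy⟩ hby
          obtain ⟨z, hz, -⟩ := hthird q q
          have := two_le_edgeCut_cycleGraph (S := {y | (b, y) ∈ U}) hby (hj (b, z) ⟨rfl, hz⟩)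
          rw [if_pos hy]
          split_ifs <;> omega
        · have := two_le_edgeCut_cycleGraph (S := {x | (x, y) ∈ U}) hay hby
          split_ifs <;> omega
      · have hy : y = p := by
          by_contra hy
          exact hay (hi (a, y) ⟨rfl, hy⟩)
        obtain ⟨z, hz, -⟩ := hthird p p
        have := two_le_edgeCut_cycleGraph (S := {y | (a, y) ∈ U}) (hi (a, z) ⟨rfl, hz⟩) hay
        rw [if_pos hy]
        split_ifs <;> omega
    have h1 := Finset.sum_le_sum fun y (_ : y ∈ Finset.univ) => hrow y
    simp [Finset.sum_add_distrib] at h1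
    have h2 := Finset.sum_le_sum_of_subset_of_nonneg (Finset.subset_univ {a, b})
      (f := fun x => edgeCut (cycleGraph (l + 3)) {y | (x, y) ∈ U})
      fun _ _ _ => edgeCut_nonneg _
    rw [Finset.sum_pair hab] at h2
    rw [edgeCut_boxProd]
    push_cast
    linarith

end Bounds

end ChipFiring

/-- For `n ≥ 2`, `2n − 1 ≤ gon(Y_{2n,n}) ≤ 2n`; and for `n ≥ 3`,
`2n − 2 ≤ gon(T_{n,n}) ≤ 2n` and `2n − 1 ≤ gon(T_{n+1,n}) ≤ 2n`. -/
theorem gonality_exceptional_bounds :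
    (∀ n : ℕ, 2 ≤ n →
      2 * n - 1 ≤ gonality (stackedPrism (2 * n) n) ∧
        gonality (stackedPrism (2 * n) n) ≤ 2 * n) ∧
    (∀ n : ℕ, 3 ≤ n →
      (2 * n - 2 ≤ gonality (toroidalGrid n n) ∧ gonality (toroidalGrid n n) ≤ 2 * n) ∧
      (2 * n - 1 ≤ gonality (toroidalGrid (n + 1) n) ∧
        gonality (toroidalGrid (n + 1) n) ≤ 2 * n)) := by
  refine ⟨fun n hn => ?_, fun n hn => ⟨?_, ?_⟩⟩
  · obtain ⟨k, hk⟩ : ∃ k, 2 * n = k + 3 := ⟨2 * n - 3, by omega⟩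
    have hP : (pathGraph n).Connected := by
      obtain ⟨l, rfl⟩ : ∃ l, n = l + 1 := ⟨n - 1, by omega⟩
      exact pathGraph_connected l
    have hlow := le_gonality_cycleGraph_boxProd_of_connected (k := k) hP (d := 2 * n)
      hk.le (by simp)
    have hup := gonality_cycleGraph_boxProd_le (k := k) (H := pathGraph n)
    rw [← hk] at hlow hup
    rw [Fintype.card_fin] at hup
    exact ⟨(Nat.sub_le _ _).trans hlow, hup⟩
  · obtain ⟨l, rfl⟩ : ∃ l, n = l + 3 := ⟨n - 3, by omega⟩
    have hup := gonality_cycleGraph_boxProd_le (k := l) (H := cycleGraph (l + 3))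
    rw [Fintype.card_fin] at hup
    exact ⟨(Nat.sub_le _ _).trans (le_gonality_toroidalGrid le_rfl), hup⟩
  · obtain ⟨l, rfl⟩ : ∃ l, n = l + 3 := ⟨n - 3, by omega⟩
    have hup := gonality_cycleGraph_boxProd_le (k := l + 1) (H := cycleGraph (l + 3))
    rw [Fintype.card_fin] at hup
    exact ⟨(Nat.sub_le _ _).trans (le_gonality_toroidalGrid (Nat.le_succ l)), hup⟩
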